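/- The relation ⋖ on finite subsets of E (defined by comparing first cardinality, then Parikh vectors lexicographically, then Foata normal forms lexicographically) is well-founded; moreover, if 𝓔₁ is a strict subset of 𝓔₂ then 𝓔₁ ⋖ 𝓔₂. -/

import Mathlib

/-!
STATEMENT 14: The relation ⋖ on finite subsets of E (comparing first cardinality, then
Parikh vectors lexicographically, then Foata normal forms lexicographically) is
well-founded; moreover if 𝓔₁ ⊂ 𝓔₂ then 𝓔₁ ⋖ 𝓔₂.
-/

namespace Foata

attribute [local instance] Classical.propDecidable

noncomputable section

variable {E : Type*} [PartialOrder E] {N : ℕ}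

/-- The Parikh vector of a finite set of events: for each label `a`, the number of
elements with label `a`. -/
def parikh (ℓ : E → Fin N) (𝓔 : Finset E) : Fin N → ℕ :=
  fun a => (𝓔.filter fun e => ℓ e = a).card

/-- Lexicographic (strict) order on vectors `Fin N → ℕ`. -/
def vecLt (v w : Fin N → ℕ) : Prop :=
  ∃ i : Fin N, (∀ j : Fin N, j < i → v j = w j) ∧ v i < w i

/-- The union `E₁ ∪ … ∪ E_i` of the first `i` Foata layers of `𝓔`. -/
def uptoLayer (𝓔 : Finset E) : ℕ → Finset E
  | 0 => ∅
  | i + 1 =>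
      uptoLayer 𝓔 i ∪
        𝓔.filter fun e => e ∉ uptoLayer 𝓔 i ∧ ∀ e' ∈ 𝓔, e' < e → e' ∈ uptoLayer 𝓔 i

/-- The `(i+1)`-st Foata layer `E_{i+1}` of `𝓔`: the elements not in the previous
layers all of whose strict predecessors in `𝓔` lie in the previous layers (for `i = 0`
this is the set of minimal elements of `𝓔`). -/
def layer (𝓔 : Finset E) (i : ℕ) : Finset E :=
  𝓔.filter fun e => e ∉ uptoLayer 𝓔 i ∧ ∀ e' ∈ 𝓔, e' < e → e' ∈ uptoLayer 𝓔 i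

/-- The number of nonempty Foata layers (the first index whose layer is empty). -/
def numLayers (𝓔 : Finset E) : ℕ :=
  if h : ∃ i, layer 𝓔 i = ∅ then Nat.find h else 0

/-- The Foata normal form `FC(𝓔)`: the list of Parikh vectors of the Foata layers,
up to the last nonempty layer. -/
def foata (ℓ : E → Fin N) (𝓔 : Finset E) : List (Fin N → ℕ) :=
  (List.range (numLayers 𝓔)).map fun i => parikh ℓ (layer 𝓔 i)

/-- The total adequate order `⋖`: compare cardinalities, then Parikh vectors
lexicographically, then Foata normal forms lexicographically. -/
def cless (ℓ : E → Fin N) (𝓔₁ 𝓔₂ : Finset E) : Prop :=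
  𝓔₁.card < 𝓔₂.card ∨
  (𝓔₁.card = 𝓔₂.card ∧ vecLt (parikh ℓ 𝓔₁) (parikh ℓ 𝓔₂)) ∨
  (𝓔₁.card = 𝓔₂.card ∧ parikh ℓ 𝓔₁ = parikh ℓ 𝓔₂ ∧
    List.Lex vecLt (foata ℓ 𝓔₁) (foata ℓ 𝓔₂))

theorem vecLt_wellFounded : WellFounded (vecLt (N := N)) :=
  Pi.Lex.wellFounded (ι := Fin N) (α := fun _ => ℕ) (· < ·) fun _ => wellFounded_lt

theorem uptoLayer_succ (𝓔 : Finset E) (i : ℕ) :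
    uptoLayer 𝓔 (i + 1) = uptoLayer 𝓔 i ∪ layer 𝓔 i := rfl

theorem uptoLayer_subset (𝓔 : Finset E) (i : ℕ) : uptoLayer 𝓔 i ⊆ 𝓔 := by
  induction i with
  | zero => exact Finset.empty_subset _
  | succ i ih => exact Finset.union_subset ih (Finset.filter_subset _ _)

theorem disjoint_uptoLayer_layer (𝓔 : Finset E) (i : ℕ) :
    Disjoint (uptoLayer 𝓔 i) (layer 𝓔 i) :=
  Finset.disjoint_right.2 fun _ h => (Finset.mem_filter.1 h).2.1

theorem layer_nonempty {𝓔 : Finset E} {i : ℕ} (hi : i < numLayers 𝓔) :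
    (layer 𝓔 i).Nonempty := by
  rw [numLayers] at hi
  split_ifs at hi with h
  · exact Finset.nonempty_iff_ne_empty.2 (Nat.find_min h hi)
  · exact absurd hi (Nat.not_lt_zero i)

theorem le_card_uptoLayer {𝓔 : Finset E} {i : ℕ} (hi : i ≤ numLayers 𝓔) :
    i ≤ (uptoLayer 𝓔 i).card := by
  induction i with
  | zero => exact Nat.zero_le _
  | succ i ih =>
    rw [uptoLayer_succ, Finset.card_union_of_disjoint (disjoint_uptoLayer_layer 𝓔 i)]
    exact Nat.add_le_add (ih (Nat.le_of_succ_le hi)) (layer_nonempty hi).card_pos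

theorem length_foata_le_card (ℓ : E → Fin N) (𝓔 : Finset E) :
    (foata ℓ 𝓔).length ≤ 𝓔.card := by
  rw [foata, List.length_map, List.length_range]
  exact (le_card_uptoLayer le_rfl).trans (Finset.card_le_card (uptoLayer_subset 𝓔 _))

/-- The lexicographic extension of a well-founded relation is well-founded on lists of
bounded length. -/
theorem acc_lex_of_length_le {α : Type*} {r : α → α → Prop} (hr : WellFounded r) (n : ℕ)
    (l : List α) (hl : l.length ≤ n) :
    Acc (fun l₁ l₂ => l₁.length ≤ n ∧ List.Lex r l₁ l₂) l := by
  induction n generalizing l with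
  | zero =>
    refine ⟨_, fun l' ⟨_, h⟩ => ?_⟩
    rw [List.length_eq_zero_iff.1 (Nat.le_zero.1 hl)] at h
    cases h
  | succ n ih =>
    have acc_nil : Acc (fun l₁ l₂ => l₁.length ≤ n + 1 ∧ List.Lex r l₁ l₂) [] :=
      ⟨_, fun _ ⟨_, h⟩ => by cases h⟩
    cases l with
    | nil => exact acc_nil
    | cons a l =>
      induction a using hr.induction generalizing l with
      | _ a iha =>
        have hl' : l.length ≤ n := Nat.le_of_succ_le_succ hl
        induction ih l hl' with
        | intro l _ ihl =>
          refine ⟨_, fun l' ⟨hlen, h⟩ => ?_⟩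
          cases h with
          | nil => exact acc_nil
          | cons h =>
            have hlen' := Nat.le_of_succ_le_succ hlen
            exact ihl _ ⟨hlen', h⟩ hlen hlen'
          | rel h => exact iha _ h _ hlen

theorem cless_wellFounded (ℓ : E → Fin N) : WellFounded (cless ℓ) := by
  suffices h : ∀ (n : ℕ) (v : Fin N → ℕ) (l : List (Fin N → ℕ)) (𝓔 : Finset E),
      𝓔.card = n → parikh ℓ 𝓔 = v → foata ℓ 𝓔 = l → Acc (cless ℓ) 𝓔 from
    ⟨fun 𝓔 => h _ _ _ 𝓔 rfl rfl rfl⟩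
  intro n
  induction n using Nat.strong_induction_on with
  | _ n ihn =>
    intro v
    induction v using vecLt_wellFounded.induction with
    | _ v ihv =>
      intro l 𝓔 hn hv hl
      have hlen : l.length ≤ n := hl ▸ hn ▸ length_foata_le_card ℓ 𝓔
      induction acc_lex_of_length_le vecLt_wellFounded n l hlen generalizing 𝓔 with
      | intro l _ ihl =>
        subst hn hv hl
        refine ⟨_, fun 𝓔' h => ?_⟩
        rcases h with h | ⟨hc, h⟩ | ⟨hc, hp, h⟩
        · exact ihn _ h _ _ _ rfl rfl rfl
        · exact ihv _ h _ _ hc rfl rfl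
        · have hlen' := hc ▸ length_foata_le_card ℓ 𝓔'
          exact ihl _ ⟨hlen', h⟩ 𝓔' hc hp rfl hlen'

theorem cless_wellFounded_and_ssubset (ℓ : E → Fin N) :
    WellFounded (cless ℓ) ∧
    ∀ 𝓔₁ 𝓔₂ : Finset E, 𝓔₁ ⊂ 𝓔₂ → cless ℓ 𝓔₁ 𝓔₂ :=
  ⟨cless_wellFounded ℓ, fun _ _ h => Or.inl (Finset.card_lt_card h)⟩

end

end Foata
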